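/- Let k be a field, L a Lie algebra over k, and f ∈ L a nonzero element such that ad(f) : L → L is locally nilpotent. Then S = {ι(f)^n : n ∈ ℕ} is a multiplicative set of regular elements of the universal enveloping algebra U(L) such that for every u ∈ U(L) and n ∈ ℕ there exists m ∈ ℕ with u·ι(f)^m ∈ ι(f)^n·U(L); consequently the Ore localization U_f := S⁻¹U(L) exists and the canonical map U(L) → S⁻¹U(L) is an injective ring homomorphism. -/

import Mathlib

open OreLocalization

set_option linter.unusedSectionVars false

noncomputable section PBW

namespace PBW

variable {k : Type*} [Field k] {L : Type*} [LieRing L] [LieAlgebra k L]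
variable {I : Type*} [LinearOrder I] (b : Module.Basis I k L)

abbrev Pol (k I : Type*) [Field k] := Multiset I →₀ k

variable (k) in
def z (M : Multiset I) : Pol k I := Finsupp.single M 1

variable (k I) in
def dg (n : ℕ) : Submodule k (Pol k I) :=
  Submodule.span k ((fun M => z k M) '' {M | Multiset.card M ≤ n})

lemma z_mem {M : Multiset I} {n : ℕ} (h : Multiset.card M ≤ n) : z k M ∈ dg k I n :=
  Submodule.subset_span ⟨M, h, rfl⟩

lemma dg_mono {m n : ℕ} (h : m ≤ n) : dg k I m ≤ dg k I n :=
  Submodule.span_mono (Set.image_mono fun _ hM => le_trans hM h)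

lemma cases_min (i : I) (M : Multiset I) : (∀ l ∈ M, i ≤ l) ∨
    ∃ j N, M = j ::ₘ N ∧ j < i ∧ ∀ l ∈ N, j ≤ l := by
  by_cases h : ∀ l ∈ M, i ≤ l
  · exact Or.inl h
  · right
    push Not at h
    obtain ⟨l, hl, hli⟩ := h
    obtain ⟨j, hj, hmin⟩ := Finset.exists_min_image M.toFinset id ⟨l, by simpa using hl⟩
    simp only [Multiset.mem_toFinset, id] at hj hmin
    refine ⟨j, M.erase j, (Multiset.cons_erase hj).symm, (hmin l hl).trans_lt hli, ?_⟩
    intro l' hl'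
    exact hmin l' (Multiset.mem_of_mem_erase hl')

abbrev Act (k L I : Type*) [Field k] [LieRing L] [LieAlgebra k L] :=
  L →ₗ[k] Pol k I →ₗ[k] Pol k I

open Classical in
def step (T : Act k L I) : Act k L I :=
  b.constr k fun i => Finsupp.linearCombination k fun M =>
    if h : ∃ j ∈ M, j < i ∧ ∀ l ∈ M, j ≤ l then
      z k (i ::ₘ M) + T (b h.choose) (T (b i) (z k (M.erase h.choose))
        - z k (i ::ₘ M.erase h.choose)) + T ⁅b i, b h.choose⁆ (z k (M.erase h.choose))
    else z k (i ::ₘ M)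

lemma step_le (T : Act k L I) {i : I} {M : Multiset I} (h : ∀ l ∈ M, i ≤ l) :
    step b T (b i) (z k M) = z k (i ::ₘ M) := by
  have h' : ¬ ∃ j ∈ M, j < i ∧ ∀ l ∈ M, j ≤ l := by
    rintro ⟨j, hj, hji, -⟩
    exact absurd (h j hj) (not_le.2 hji)
  rw [step, Module.Basis.constr_basis, z, Finsupp.linearCombination_single, one_smul, dif_neg h']

lemma step_lt (T : Act k L I) {i j : I} {N : Multiset I} (hji : j < i) (h : ∀ l ∈ N, j ≤ l) :
    step b T (b i) (z k (j ::ₘ N)) = z k (i ::ₘ j ::ₘ N) +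
      T (b j) (T (b i) (z k N) - z k (i ::ₘ N)) + T ⁅b i, b j⁆ (z k N) := by
  have h' : ∃ j' ∈ j ::ₘ N, j' < i ∧ ∀ l ∈ j ::ₘ N, j' ≤ l :=
    ⟨j, Multiset.mem_cons_self _ _, hji, by simpa using h⟩
  have hc : h'.choose = j := by
    apply le_antisymm
    · exact h'.choose_spec.2.2 j (Multiset.mem_cons_self _ _)
    · rcases Multiset.mem_cons.1 h'.choose_spec.1 with e | e
      · exact e.ge
      · exact h _ e
  rw [step, Module.Basis.constr_basis, z, Finsupp.linearCombination_single, one_smul, dif_pos h',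
    hc, Multiset.erase_cons_head]

def A : ℕ → Act k L I
  | 0 => step b 0
  | n + 1 => step b (A n)

/-- leading term -/
def Lead (T : Act k L I) : Prop :=
  ∀ i M, T (b i) (z k M) - z k (i ::ₘ M) ∈ dg k I (Multiset.card M)

variable {b} in
lemma Lead.mem {T : Act k L I} (hT : Lead b T) (x : L) {n : ℕ} {p : Pol k I}
    (hp : p ∈ dg k I n) : T x p ∈ dg k I (n + 1) := by
  induction hp using Submodule.span_induction with
  | mem p hp =>
    obtain ⟨M, hM, rfl⟩ := hp
    have hM : Multiset.card M ≤ n := hM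
    have hx := b.mem_span x
    induction hx using Submodule.span_induction with
    | mem x hx =>
      obtain ⟨i, rfl⟩ := hx
      rw [← sub_add_cancel (T (b i) (z k M)) (z k (i ::ₘ M))]
      exact add_mem (dg_mono (by omega) (hT i M)) (z_mem (by simpa using hM))
    | zero => simp
    | add x y _ _ hx hy => simpa using add_mem hx hy
    | smul c x _ hx => simpa using Submodule.smul_mem _ c hx
  | zero => simp
  | add x y _ _ hx hy => simpa using add_mem hx hy
  | smul c x _ hx => simpa using Submodule.smul_mem _ c hx

lemma lead_step {T : Act k L I} (hT : Lead b T) : Lead b (step b T) := by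
  intro i M
  rcases cases_min i M with h | ⟨j, N, rfl, hji, h⟩
  · rw [step_le b T h, sub_self]; exact zero_mem _
  · rw [step_lt b T hji h, add_assoc, add_sub_cancel_left, Multiset.card_cons]
    exact add_mem (hT.mem _ (hT i N)) (hT.mem _ (z_mem le_rfl))

lemma lead_step_zero : Lead b (step b 0) := by
  intro i M
  rcases cases_min i M with h | ⟨j, N, rfl, hji, h⟩
  · rw [step_le b _ h, sub_self]; exact zero_mem _
  · rw [step_lt b _ hji h]; simp

lemma lead_A (n : ℕ) : Lead b (A b n) := by
  induction n with
  | zero => exact lead_step_zero b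
  | succ n ih => exact lead_step b ih

lemma A_succ (n : ℕ) : A b (n + 1) = step b (A b n) := rfl

variable {b} in
lemma agree_of {T T' : Act k L I} {n : ℕ}
    (h : ∀ i M, Multiset.card M ≤ n → T (b i) (z k M) = T' (b i) (z k M))
    (x : L) {p : Pol k I} (hp : p ∈ dg k I n) : T x p = T' x p := by
  induction hp using Submodule.span_induction with
  | mem p hp =>
    obtain ⟨M, hM, rfl⟩ := hp
    have hx := b.mem_span x
    induction hx using Submodule.span_induction with
    | mem x hx => obtain ⟨i, rfl⟩ := hx; exact h i M hM
    | zero => simp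
    | add x y _ _ hx hy => simp [hx, hy]
    | smul c x _ hx => simp [hx]
  | zero => simp
  | add x y _ _ hx hy => simp [hx, hy]
  | smul c x _ hx => simp [hx]

lemma A_stable (n : ℕ) : ∀ i M, Multiset.card M ≤ n →
    A b (n + 1) (b i) (z k M) = A b n (b i) (z k M) := by
  induction n with
  | zero =>
    intro i M hM
    obtain rfl : M = 0 := by simpa using hM
    rw [A, A, step_le b _ (by simp), step_le b _ (by simp)]
  | succ n ih =>
    intro i M hM
    rcases cases_min i M with h | ⟨j, N, rfl, hji, h⟩
    · rw [A_succ, A_succ, step_le b _ h, step_le b _ h]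
    · have hN : Multiset.card N ≤ n := by simpa using hM
      rw [A_succ b (n+1), A_succ b n, step_lt b _ hji h, step_lt b _ hji h, ← A_succ,
        ih i N hN, agree_of ih _ (z_mem hN),
        agree_of ih _ (dg_mono hN (lead_A b n i N))]

lemma A_stable' (m n : ℕ) (i : I) (M : Multiset I) (hM : Multiset.card M ≤ n) :
    A b (n + m) (b i) (z k M) = A b n (b i) (z k M) := by
  induction m with
  | zero => rfl
  | succ m ih => rw [← add_assoc, A_stable b (n + m) i M (by omega), ih]

def act : Act k L I :=
  b.constr k fun i => Finsupp.linearCombination k fun M => A b (Multiset.card M) (b i) (z k M)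

lemma act_basis (i : I) (M : Multiset I) :
    act b (b i) (z k M) = A b (Multiset.card M) (b i) (z k M) := by
  rw [act, Module.Basis.constr_basis, z, Finsupp.linearCombination_single, one_smul]; rfl

lemma act_eq_A (n : ℕ) (i : I) (M : Multiset I) (hM : Multiset.card M ≤ n) :
    act b (b i) (z k M) = A b n (b i) (z k M) := by
  obtain ⟨m, rfl⟩ := Nat.exists_eq_add_of_le hM
  rw [act_basis, A_stable' b _ _ _ _ le_rfl]

lemma lead_act : Lead b (act b) := by
  intro i M
  rw [act_basis]; exact lead_A b _ i M

lemma act_le {i : I} {M : Multiset I} (h : ∀ l ∈ M, i ≤ l) :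
    act b (b i) (z k M) = z k (i ::ₘ M) := by
  rw [act_eq_A b (Multiset.card M + 1) i M (by omega), A_succ, step_le b _ h]

lemma act_lt {i j : I} {N : Multiset I} (hji : j < i) (h : ∀ l ∈ N, j ≤ l) :
    act b (b i) (z k (j ::ₘ N)) =
      act b (b j) (act b (b i) (z k N)) + act b ⁅b i, b j⁆ (z k N) := by
  have e := act_eq_A b (Multiset.card N + 1) i (j ::ₘ N) (by simp)
  have hA := act_eq_A b (Multiset.card N)
  rw [A_succ, step_lt b _ hji h, ← hA i N le_rfl, ← agree_of hA _ (z_mem le_rfl),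
    ← agree_of hA _ (lead_act b i N), map_sub, act_le b (i := j) (M := i ::ₘ N)
      (by simpa using ⟨hji.le, h⟩), Multiset.cons_swap i j N] at e
  rw [e]; abel

def Comm (x y : L) (p : Pol k I) : Prop :=
  act b x (act b y p) = act b y (act b x p) + act b ⁅x, y⁆ p

variable {b} in
lemma comm_symm {x y : L} {p : Pol k I} (h : Comm b x y p) : Comm b y x p := by
  unfold Comm at *
  rw [h, ← lie_skew x y, map_neg, LinearMap.neg_apply]; abel

variable {b} in
lemma comm_of {n : ℕ} (h : ∀ i j M, Multiset.card M ≤ n → Comm b (b i) (b j) (z k M))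
    (x y : L) {p : Pol k I} (hp : p ∈ dg k I n) : Comm b x y p := by
  unfold Comm at *
  induction hp using Submodule.span_induction with
  | mem p hp =>
    obtain ⟨M, hM, rfl⟩ := hp
    have hx := b.mem_span x
    induction hx using Submodule.span_induction with
    | mem x hx =>
      obtain ⟨i, rfl⟩ := hx
      have hy := b.mem_span y
      induction hy using Submodule.span_induction with
      | mem y hy => obtain ⟨j, rfl⟩ := hy; exact h i j M hM
      | zero => simp
      | add x y _ _ hx hy => simp [hx, hy]; abel
      | smul c x _ hx => simp [hx]
    | zero => simp
    | add x y _ _ hx hy => simp [hx, hy]; abel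
    | smul c x _ hx => simp [hx]
  | zero => simp
  | add x y _ _ hx hy => simp [hx, hy]; abel
  | smul c x _ hx => simp [hx]

lemma comm_le {i j : I} {M : Multiset I} (hji : j < i) (h : ∀ l ∈ M, j ≤ l) :
    Comm b (b i) (b j) (z k M) := by
  unfold Comm
  rw [act_le b h, act_lt b hji h]

lemma comm_basis (n : ℕ) : ∀ i j M, Multiset.card M ≤ n → Comm b (b i) (b j) (z k M) := by
  induction n with
  | zero =>
    intro i j M hM
    obtain rfl : M = 0 := by simpa using hM
    rcases lt_trichotomy i j with h | rfl | h
    · exact comm_symm (comm_le b h (by simp))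
    · simp [Comm]
    · exact comm_le b h (by simp)
  | succ n ih =>
    have key : ∀ i j M, Multiset.card M ≤ n + 1 → j < i → Comm b (b i) (b j) (z k M) := by
      intro i j M hM hji
      rcases cases_min j M with h | ⟨m, N, rfl, hmj, h⟩
      · exact comm_le b hji h
      have hN : Multiset.card N ≤ n := by simpa using hM
      have hmi := hmj.trans hji
      have hz := act_le b h
      have ihN := fun x y => comm_of ih x y (z_mem hN)
      -- x_a x_m (x_c z_N)
      have aux : ∀ a c, m < a → m < c →
          Comm b (b a) (b m) (act b (b c) (z k N)) := by
        intro a c hma hmc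
        have h1 := comm_le b (M := c ::ₘ N) hma (by simpa using ⟨hmc.le, h⟩)
        have h2 := comm_of ih (b a) (b m) (dg_mono hN (lead_act b c N))
        unfold Comm at *
        simp only [map_sub] at h2
        have h3 := congrArg₂ (· + ·) h1 h2
        simp only [add_sub_cancel] at h3
        rw [h3]; abel
      have e1 := aux i j hmi hmj
      have e2 := aux j i hmj hmi
      have e3 := ihN (b i) ⁅b j, b m⁆
      have e4 := ihN (b j) ⁅b i, b m⁆
      have e5 := ihN ⁅b i, b j⁆ (b m)
      have e6 := ihN (b i) (b j)
      have e7 := ihN (b i) (b m)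
      have e8 := ihN (b j) (b m)
      clear ihN aux ih
      unfold Comm at e1 e2 e3 e4 e5 e6 e7 e8 ⊢
      rw [← hz, e5, e7, e8, map_add, map_add, e1, e2, e3, e4, e6, lie_lie, map_add, map_sub,
        LinearMap.sub_apply]
      abel
    intro i j M hM
    rcases lt_trichotomy i j with h | rfl | h
    · exact comm_symm (key _ _ _ hM h)
    · simp [Comm]
    · exact key _ _ _ hM h

lemma exists_dg (p : Pol k I) : ∃ n, p ∈ dg k I n := by
  induction p using Finsupp.induction_linear with
  | zero => exact ⟨0, zero_mem _⟩
  | add p q hp hq =>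
    obtain ⟨m, hm⟩ := hp
    obtain ⟨n, hn⟩ := hq
    exact ⟨m + n, add_mem (dg_mono (by omega) hm) (dg_mono (by omega) hn)⟩
  | single M c =>
    refine ⟨Multiset.card M, ?_⟩
    have : Finsupp.single M c = c • z k M := by simp [z]
    rw [this]
    exact Submodule.smul_mem _ _ (z_mem le_rfl)

lemma comm_all (x y : L) (p : Pol k I) : Comm b x y p := by
  obtain ⟨n, hn⟩ := exists_dg p
  exact comm_of (comm_basis b n) x y hn

attribute [local instance] LieRing.ofAssociativeRing

def rep : L →ₗ⁅k⁆ Module.End k (Pol k I) :=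
  { act b with
    map_lie' := by
      intro x y
      apply LinearMap.ext
      intro p
      have h := comm_all b x y p
      unfold Comm at h
      change act b ⁅x, y⁆ p = act b x (act b y p) - act b y (act b x p)
      rw [h]; abel }

def Rep : UniversalEnvelopingAlgebra k L →ₐ[k] Module.End k (Pol k I) :=
  UniversalEnvelopingAlgebra.lift k (rep b)

lemma Rep_ι (x : L) (p : Pol k I) : Rep b (UniversalEnvelopingAlgebra.ι k x) p = act b x p := by
  rw [Rep, UniversalEnvelopingAlgebra.lift_ι_apply]; rfl

local notation "ιU" => UniversalEnvelopingAlgebra.ι k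

def τ : Pol k I →ₗ[k] UniversalEnvelopingAlgebra k L :=
  Finsupp.linearCombination k fun M => ((M.sort (· ≤ ·)).map fun i => ιU (b i)).prod

lemma τ_z (M : Multiset I) : τ b (z k M) = ((M.sort (· ≤ ·)).map fun i => ιU (b i)).prod := by
  rw [τ, z, Finsupp.linearCombination_single, one_smul]

lemma τ_cons {i : I} {M : Multiset I} (h : ∀ l ∈ M, i ≤ l) :
    τ b (z k (i ::ₘ M)) = ιU (b i) * τ b (z k M) := by
  rw [τ_z, τ_z, Multiset.sort_cons (r := (· ≤ ·)) i M h]; simp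

variable {b} in
lemma τ_of {n : ℕ} 
    (h : ∀ i M, Multiset.card M ≤ n → τ b (act b (b i) (z k M)) = ιU (b i) * τ b (z k M))
    (x : L) {p : Pol k I} (hp : p ∈ dg k I n) : τ b (act b x p) = ιU x * τ b p := by
  induction hp using Submodule.span_induction with
  | mem p hp =>
    obtain ⟨M, hM, rfl⟩ := hp
    have hx := b.mem_span x
    induction hx using Submodule.span_induction with
    | mem x hx => obtain ⟨i, rfl⟩ := hx; exact h i M hM
    | zero => simp only [map_zero, LinearMap.zero_apply, zero_mul]
    | add x y _ _ hx hy => simp only [map_add, LinearMap.add_apply, hx, hy, add_mul]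
    | smul c x _ hx => simp only [map_smul, LinearMap.smul_apply, hx, smul_mul_assoc]
  | zero => simp only [map_zero, mul_zero]
  | add x y _ _ hx hy => simp only [map_add, hx, hy, mul_add]
  | smul c x _ hx => simp only [map_smul, hx, mul_smul_comm]

lemma τ_basis (n : ℕ) :
    ∀ i M, Multiset.card M ≤ n → τ b (act b (b i) (z k M)) = ιU (b i) * τ b (z k M) := by
  induction n with
  | zero =>
    intro i M hM
    obtain rfl : M = 0 := by simpa using hM
    rw [act_le b (by simp), τ_cons b (by simp)]
  | succ n ih =>
    intro i M hM
    rcases cases_min i M with h | ⟨j, N, rfl, hji, h⟩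
    · rw [act_le b h, τ_cons b h]
    have hN : Multiset.card N ≤ n := by simpa using hM
    have hle : ∀ l ∈ i ::ₘ N, j ≤ l := by simpa using ⟨hji.le, h⟩
    have e := τ_of ih (b j) (dg_mono hN (lead_act b i N))
    rw [map_sub, map_sub, map_sub, act_le b hle, τ_cons b hle, mul_sub, sub_left_inj, ih i N hN] at e
    rw [act_lt b hji h, map_add, e, τ_of ih _ (z_mem hN), τ_cons b h, LieHom.map_lie,
      LieRing.of_associative_ring_bracket]
    noncomm_ring

lemma τ_act (x : L) (p : Pol k I) : τ b (act b x p) = ιU x * τ b p := by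
  obtain ⟨n, hn⟩ := exists_dg p
  exact τ_of (τ_basis b n) x hn

/-- generators -/
lemma U_induction {C : UniversalEnvelopingAlgebra k L → Prop}
    (h0 : ∀ r, C (algebraMap k _ r)) (h1 : ∀ x, C (ιU x)) (hm : ∀ a c, C a → C c → C (a * c))
    (ha : ∀ a c, C a → C c → C (a + c)) (u : UniversalEnvelopingAlgebra k L) : C u := by
  obtain ⟨t, rfl⟩ : ∃ t, UniversalEnvelopingAlgebra.mkAlgHom k L t = u :=
    RingCon.mk'_surjective _ u
  induction t using TensorAlgebra.induction with
  | algebraMap r => rw [AlgHom.commutes]; exact h0 r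
  | ι x => exact h1 x
  | mul a c iha ihc => rw [map_mul]; exact hm _ _ iha ihc
  | add a c iha ihc => rw [map_add]; exact ha _ _ iha ihc

lemma τ_Rep (u : UniversalEnvelopingAlgebra k L) : ∀ p, τ b (Rep b u p) = u * τ b p := by
  induction u using U_induction with
  | h0 r => intro p; rw [AlgHom.commutes, Module.algebraMap_end_apply, map_smul, Algebra.smul_def]
  | h1 x => intro p; rw [Rep_ι, τ_act]
  | hm a c ha hc => intro p; rw [map_mul, Module.End.mul_apply, ha, hc, mul_assoc]
  | ha a c ha hc => intro p; rw [map_add, LinearMap.add_apply, map_add, ha, hc, add_mul]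

lemma τ_Rep_one (u : UniversalEnvelopingAlgebra k L) : τ b (Rep b u (z k 0)) = u := by
  rw [τ_Rep, τ_z]; simp

lemma left_regular_basis (i : I) (hi : ∀ j, i ≤ j) (u : UniversalEnvelopingAlgebra k L)
    (h : ιU (b i) * u = 0) : u = 0 := by
  have e : ∀ p, act b (b i) p = Finsupp.mapDomain (fun M => i ::ₘ M) p := by
    intro p
    induction p using Finsupp.induction_linear with
    | zero => simp
    | add p q hp hq => rw [map_add, hp, hq, Finsupp.mapDomain_add]
    | single M c =>
      have : Finsupp.single M c = c • z k M := by simp [z]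
      rw [this, map_smul, act_le b (fun l _ => hi l), Finsupp.mapDomain_smul, z, z,
        Finsupp.mapDomain_single]
  have h2 : Rep b (ιU (b i) * u) (z k 0) = 0 := by rw [h]; simp
  rw [map_mul, Module.End.mul_apply, Rep_ι, e] at h2
  have h3 : Rep b u (z k 0) = 0 := by
    apply Finsupp.mapDomain_injective (f := fun M => i ::ₘ M)
      (fun M N hMN => (Multiset.cons_inj_right i).1 hMN)
    rw [h2, Finsupp.mapDomain_zero]
  rw [← τ_Rep_one b u, h3, map_zero]

end PBW

open PBW

attribute [local instance] LieRing.ofAssociativeRing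

lemma exists_order {X : Type*} (i0 : X) : ∃ o : LinearOrder X, ∀ j, o.le i0 j := by
  classical
  let o1 : LinearOrder X := linearOrderOfSTO WellOrderingRel
  let g : X → WithBot X := fun i => if i = i0 then ⊥ else (i : WithBot X)
  have hg : Function.Injective g := by
    intro i j hij
    simp only [g] at hij
    split_ifs at hij with h1 h2 h2
    · rw [h1, h2]
    · exact absurd hij.symm (WithBot.coe_ne_bot)
    · exact absurd hij (WithBot.coe_ne_bot)
    · exact WithBot.coe_injective hij
  have hle : ∀ j, g i0 ≤ g j := by intro j; simp [g]
  exact ⟨LinearOrder.lift' g hg, hle⟩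

lemma left_regular {k : Type*} [Field k] {L : Type*} [LieRing L] [LieAlgebra k L]
    {f : L} (hf : f ≠ 0) (u : UniversalEnvelopingAlgebra k L)
    (h : UniversalEnvelopingAlgebra.ι k f * u = 0) : u = 0 := by
  classical
  have hs : LinearIndepOn k id ({f} : Set L) := LinearIndepOn.singleton hf
  let b := Module.Basis.extend hs
  let i0 : hs.extend (Set.subset_univ _) := ⟨f, hs.subset_extend _ rfl⟩
  have hb : b i0 = f := Module.Basis.extend_apply_self hs i0
  obtain ⟨o, ho⟩ := exists_order i0
  exact @left_regular_basis k _ L _ _ _ o b i0 ho u (by rw [hb]; exact h)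

section ring
variable {R : Type*} [Ring R] (f : R)

/-- the commutator -/
def D (u : R) : R := f * u - u * f

lemma D_zero_iter (n : ℕ) : (D f)^[n] 0 = 0 := Function.iterate_fixed (by simp [D]) n

lemma D_iter_le {m n : ℕ} (h : m ≤ n) {u : R} (hu : (D f)^[m] u = 0) : (D f)^[n] u = 0 := by
  obtain ⟨d, rfl⟩ := Nat.exists_eq_add_of_le h
  rw [add_comm, Function.iterate_add_apply, hu, D_zero_iter]

lemma D_iter_add (n : ℕ) : ∀ u v : R, (D f)^[n] (u + v) = (D f)^[n] u + (D f)^[n] v := by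
  induction n with
  | zero => simp
  | succ n ih =>
    intro u v
    rw [Function.iterate_succ_apply, Function.iterate_succ_apply, Function.iterate_succ_apply,
      ← ih]
    congr 1; simp only [D]; noncomm_ring

lemma D_mul (n : ℕ) : ∀ (p q : ℕ) (u v : R), p + q ≤ n → (D f)^[p] u = 0 → (D f)^[q] v = 0 →
    (D f)^[n] (u * v) = 0 := by
  induction n with
  | zero =>
    intro p q u v h hu hv
    obtain rfl : p = 0 := by omega
    simp at hu
    simp [hu]
  | succ n ih =>
    intro p q u v h hu hv
    cases p with
    | zero => simp at hu; rw [hu, zero_mul, D_zero_iter]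
    | succ p =>
    cases q with
    | zero => simp at hv; rw [hv, mul_zero, D_zero_iter]
    | succ q =>
    have e : D f (u * v) = D f u * v + u * D f v := by simp only [D]; noncomm_ring
    rw [Function.iterate_succ_apply, e, D_iter_add,
      ih p (q+1) _ _ (by omega) hu hv, ih (p+1) q _ _ (by omega) hu hv, add_zero]

lemma ore_right (m : ℕ) : ∀ (N n : ℕ) (u : R), N + n ≤ m → (D f)^[N] u = 0 →
    ∃ v, u * f ^ m = f ^ n * v := by
  induction m with
  | zero =>
    intro N n u h hu
    obtain rfl : n = 0 := by omega
    exact ⟨u, by simp⟩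
  | succ m ih =>
    intro N n u h hu
    cases N with
    | zero => simp at hu; exact ⟨0, by simp [hu]⟩
    | succ N =>
    cases n with
    | zero => exact ⟨u * f ^ (m+1), by simp⟩
    | succ n =>
    obtain ⟨v, hv⟩ := ih (N+1) n u (by omega) hu
    obtain ⟨w, hw⟩ := ih N (n+1) (D f u) (by omega) hu
    refine ⟨v - w, ?_⟩
    have : u * f ^ (m+1) = f * (u * f ^ m) - D f u * f ^ m := by
      rw [pow_succ']; simp only [D]; noncomm_ring
    rw [this, hv, hw, mul_sub, pow_succ' f n]; noncomm_ring

lemma ore_left (m : ℕ) : ∀ (N n : ℕ) (u : R), N + n ≤ m → (D f)^[N] u = 0 →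
    ∃ v, f ^ m * u = v * f ^ n := by
  induction m with
  | zero =>
    intro N n u h hu
    obtain rfl : n = 0 := by omega
    exact ⟨u, by simp⟩
  | succ m ih =>
    intro N n u h hu
    cases N with
    | zero => simp at hu; exact ⟨0, by simp [hu]⟩
    | succ N =>
    cases n with
    | zero => exact ⟨f ^ (m+1) * u, by simp⟩
    | succ n =>
    obtain ⟨v, hv⟩ := ih (N+1) n u (by omega) hu
    obtain ⟨w, hw⟩ := ih N (n+1) (D f u) (by omega) hu
    refine ⟨v + w, ?_⟩
    have : f ^ (m+1) * u = (f ^ m * u) * f + f ^ m * D f u := by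
      rw [pow_succ]; simp only [D]; noncomm_ring
    rw [this, hv, hw, add_mul, pow_succ f n]; noncomm_ring

lemma D_right_zero (n : ℕ) : ∀ u : R, u * f = 0 → (D f)^[n] u = f ^ n * u := by
  induction n with
  | zero => simp
  | succ n ih =>
    intro u hu
    have e : D f u = f * u := by simp [D, hu]
    rw [Function.iterate_succ_apply, e, ih _ (by rw [mul_assoc, hu, mul_zero]), pow_succ, mul_assoc]

end ring

lemma D_nil {k : Type*} [Field k] {L : Type*} [LieRing L] [LieAlgebra k L]
    (f : L) (hnil : ∀ x : L, ∃ N : ℕ, (fun y => ⁅f, y⁆)^[N] x = 0)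
    (u : UniversalEnvelopingAlgebra k L) :
    ∃ N, (D (UniversalEnvelopingAlgebra.ι k f))^[N] u = 0 := by
  induction u using U_induction with
  | h0 r => exact ⟨1, by simp [D, Algebra.commutes]⟩
  | h1 x =>
    obtain ⟨N, hN⟩ := hnil x
    refine ⟨N, ?_⟩
    have : ∀ n x, (D (UniversalEnvelopingAlgebra.ι k f))^[n] (UniversalEnvelopingAlgebra.ι k x)
        = UniversalEnvelopingAlgebra.ι k ((fun y => ⁅f, y⁆)^[n] x) := by
      intro n
      induction n with
      | zero => intro x; rfl
      | succ n ih =>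
        intro x
        rw [Function.iterate_succ_apply, Function.iterate_succ_apply, ← ih, LieHom.map_lie,
          LieRing.of_associative_ring_bracket, D]
    rw [this, hN, map_zero]
  | hm a c ha hc =>
    obtain ⟨p, hp⟩ := ha
    obtain ⟨q, hq⟩ := hc
    exact ⟨p + q, D_mul _ _ p q _ _ le_rfl hp hq⟩
  | ha a c ha hc =>
    obtain ⟨p, hp⟩ := ha
    obtain ⟨q, hq⟩ := hc
    exact ⟨p + q, by rw [D_iter_add, D_iter_le _ (by omega) hp, D_iter_le _ (by omega) hq, add_zero]⟩

end PBW

/-- Let `k` be a field, `L` a Lie algebra over `k`, and `f ∈ L` a nonzero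
element with `ad(f)` locally nilpotent on `L`.  Then `S = {ι(f)^n : n ∈ ℕ}` is a
multiplicative set of regular elements of `U(L)` such that for every `u ∈ U(L)` and `n ∈ ℕ`
there is `m ∈ ℕ` with `u * ι(f)^m ∈ ι(f)^n * U(L)`; consequently the Ore localization
`U_f = S⁻¹U(L)` exists and the canonical map `U(L) → S⁻¹U(L)` is an injective ring
homomorphism. -/
theorem stmt_6 (k : Type*) [Field k] (L : Type*) [LieRing L] [LieAlgebra k L]
    (f : L) (hf : f ≠ 0) (hnil : ∀ x : L, ∃ N : ℕ, (fun y => ⁅f, y⁆)^[N] x = 0) :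
    (∀ s ∈ Submonoid.powers (UniversalEnvelopingAlgebra.ι k f),
      ∀ a : UniversalEnvelopingAlgebra k L, (s * a = 0 → a = 0) ∧ (a * s = 0 → a = 0)) ∧
    (∀ (u : UniversalEnvelopingAlgebra k L) (n : ℕ), ∃ (m : ℕ)
      (v : UniversalEnvelopingAlgebra k L),
      u * (UniversalEnvelopingAlgebra.ι k f) ^ m = (UniversalEnvelopingAlgebra.ι k f) ^ n * v) ∧
    (∃ inst : OreSet (Submonoid.powers (UniversalEnvelopingAlgebra.ι k f)),
      letI := inst
      Function.Injective
        (OreLocalization.numeratorRingHom : UniversalEnvelopingAlgebra k L →+*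
          OreLocalization (Submonoid.powers (UniversalEnvelopingAlgebra.ι k f))
            (UniversalEnvelopingAlgebra k L))) := by
  have hl : ∀ (n : ℕ) (a : UniversalEnvelopingAlgebra k L),
      (UniversalEnvelopingAlgebra.ι k f) ^ n * a = 0 → a = 0 := by
    intro n
    induction n with
    | zero => intro a h; simpa using h
    | succ n ih =>
      intro a h
      rw [pow_succ, mul_assoc] at h
      exact left_regular hf a (ih _ h)
  have hr1 : ∀ a : UniversalEnvelopingAlgebra k L,
      a * UniversalEnvelopingAlgebra.ι k f = 0 → a = 0 := by
    intro a h
    obtain ⟨N, hN⟩ := D_nil f hnil a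
    rw [D_right_zero _ _ _ h] at hN
    exact hl N a hN
  have hr : ∀ (n : ℕ) (a : UniversalEnvelopingAlgebra k L),
      a * (UniversalEnvelopingAlgebra.ι k f) ^ n = 0 → a = 0 := by
    intro n
    induction n with
    | zero => intro a h; simpa using h
    | succ n ih =>
      intro a h
      rw [pow_succ, ← mul_assoc] at h
      exact ih _ (hr1 _ h)
  refine ⟨?_, ?_, ?_⟩
  · rintro s ⟨n, rfl⟩ a
    exact ⟨hl n a, hr n a⟩
  · intro u n
    obtain ⟨N, hN⟩ := D_nil f hnil u
    exact ⟨N + n, ore_right _ _ N n u le_rfl hN⟩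
  · have hne : Nonempty (OreSet (Submonoid.powers (UniversalEnvelopingAlgebra.ι k f))) := by
      rw [nonempty_oreSet_iff]
      constructor
      · rintro r₁ r₂ ⟨s, n, rfl⟩ h
        refine ⟨1, ?_⟩
        have h2 : (r₁ - r₂) * (UniversalEnvelopingAlgebra.ι k f) ^ n = 0 := by
          rw [sub_mul, sub_eq_zero]; exact h
        rw [sub_eq_zero.1 (hr n _ h2)]
      · rintro r ⟨s, n, rfl⟩
        obtain ⟨N, hN⟩ := D_nil f hnil r
        obtain ⟨v, hv⟩ := ore_left _ _ N n r le_rfl hN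
        exact ⟨v, ⟨_, N + n, rfl⟩, hv⟩
    obtain ⟨inst⟩ := hne
    refine ⟨inst, ?_⟩
    let _ := inst
    apply numeratorHom_inj
    rintro s ⟨n, rfl⟩ a h
    exact hl n a h
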